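/- (Closed form for the body component of the entropy, Gaussian case.) For all σ > 0, N_a > 0, N_b > 0 and a, b ∈ ℝ, let f(θ) = (√N_a/√(2πσ²)) exp(−N_a(θ − a)²/(2σ²)) be the density of N(a, σ²/N_a) and Φ_b(θ) = (1/2)[1 + erf(√N_b(θ − b)/√(2σ²))] the CDF of N(b, σ²/N_b). Then −∫_{−∞}^{∞} Φ_b(θ) f(θ) ln f(θ) dθ = (1/2) ln(2πσ²e/N_a) · [1 − (1/2) erfc( √(N_b N_a)(a − b) / sqrt(2σ²(N_b + N_a)) )] − ( √N_a · N_b^{3/2} (a − b) / (2σ√(2π)(N_a + N_b)^{3/2}) ) · exp(−N_b N_a (a − b)² / (2σ²(N_b + N_a))). -/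

import Mathlib

open MeasureTheory

/-- The error function `erf x = (2/√π) ∫₀ˣ e^{−u²} du`. -/
noncomputable def erf (x : ℝ) : ℝ := (2 / Real.sqrt Real.pi) * ∫ u in (0:ℝ)..x, Real.exp (-u ^ 2)

/-- The complementary error function `erfc x = 1 − erf x`. -/
noncomputable def erfc (x : ℝ) : ℝ := 1 - erf x

lemma eb_hasDeriv (x : ℝ) : HasDerivAt erf ((2 / Real.sqrt Real.pi) * Real.exp (-x ^ 2)) x := by
  have hc : Continuous (fun u : ℝ => Real.exp (-u ^ 2)) := by fun_prop
  have := (hc.integral_hasStrictDerivAt 0 x).hasDerivAt.const_mul (2 / Real.sqrt Real.pi)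
  exact this

lemma eb_cont : Continuous erf :=
  continuous_iff_continuousAt.2 fun x => (eb_hasDeriv x).continuousAt

lemma eb_odd (x : ℝ) : erf (-x) = - erf x := by
  unfold erf
  have := intervalIntegral.integral_comp_neg (a := 0) (b := x) (fun u : ℝ => Real.exp (-u ^ 2))
  simp only [neg_sq, neg_zero] at this
  rw [this, intervalIntegral.integral_symm (-x) 0]
  ring

lemma eb_gauss_int : Integrable (fun x : ℝ => Real.exp (-x ^ 2)) := by
  have := integrable_exp_neg_mul_sq (b := 1) one_pos
  simpa using this

lemma eb_gauss_val : ∫ x : ℝ, Real.exp (-x ^ 2) = Real.sqrt Real.pi := by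
  have := integral_gaussian 1
  simpa using this

lemma eb_bound (x : ℝ) : ‖erf x‖ ≤ 2 := by
  have hpi : 0 < Real.sqrt Real.pi := Real.sqrt_pos.2 Real.pi_pos
  have h1 : ‖∫ u in (0:ℝ)..x, Real.exp (-u ^ 2)‖ ≤ Real.sqrt Real.pi := by
    refine (intervalIntegral.norm_integral_le_integral_norm_uIoc).trans ?_
    rw [← eb_gauss_val]
    have : (fun u : ℝ => ‖Real.exp (-u ^ 2)‖) = fun u : ℝ => Real.exp (-u ^ 2) := by
      ext u; simp
    rw [this]
    exact setIntegral_le_integral eb_gauss_int (Filter.Eventually.of_forall fun u => (Real.exp_pos _).le)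
  unfold erf
  rw [norm_mul, Real.norm_of_nonneg (by positivity : 0 ≤ 2 / Real.sqrt Real.pi)]
  calc _ ≤ 2 / Real.sqrt Real.pi * Real.sqrt Real.pi := by gcongr
    _ = 2 := by field_simp

lemma eb_sq_int : Integrable (fun x : ℝ => x ^ 2 * Real.exp (-x ^ 2)) := by
  have := integrable_rpow_mul_exp_neg_mul_sq (b := 1) one_pos (s := 2) (by norm_num)
  simpa using this

lemma eb_id_int : Integrable (fun x : ℝ => x * Real.exp (-x ^ 2)) := by
  have := integrable_mul_exp_neg_mul_sq (b := 1) one_pos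
  simpa using this

lemma eb_mul_erf {g : ℝ → ℝ} (hg : Integrable g) (p q : ℝ) :
    Integrable (fun x => g x * erf (p * x + q)) := by
  refine hg.mul_bdd (c := 2) ?_ (Filter.Eventually.of_forall fun x => eb_bound _)
  exact (eb_cont.comp (by fun_prop)).aestronglyMeasurable

lemma eb_odd_zero (b : ℝ) : ∫ x : ℝ, x * Real.exp (-b * x ^ 2) = 0 := by
  have h := integral_neg_eq_self (fun x : ℝ => x * Real.exp (-b * x ^ 2)) volume
  simp only [neg_sq, neg_mul, integral_neg] at h ⊢
  linarith

lemma eb_sq (p q x : ℝ) : Real.exp (-x ^ 2) * Real.exp (-(p * x + q) ^ 2)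
    = Real.exp (-q ^ 2 / (1 + p ^ 2)) *
      Real.exp (-(1 + p ^ 2) * (x + p * q / (1 + p ^ 2)) ^ 2) := by
  have : 1 + p ^ 2 ≠ 0 := by positivity
  rw [← Real.exp_add, ← Real.exp_add]
  congr 1
  field_simp
  ring

lemma eb_G (p q : ℝ) : ∫ x : ℝ, Real.exp (-x ^ 2) * Real.exp (-(p * x + q) ^ 2)
    = Real.exp (-q ^ 2 / (1 + p ^ 2)) * Real.sqrt (Real.pi / (1 + p ^ 2)) := by
  simp_rw [eb_sq]
  rw [integral_const_mul,
    integral_add_right_eq_self (fun x : ℝ => Real.exp (-(1 + p ^ 2) * x ^ 2)), integral_gaussian]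

lemma eb_J (p q : ℝ) : ∫ x : ℝ, x * (Real.exp (-x ^ 2) * Real.exp (-(p * x + q) ^ 2))
    = - (p * q / (1 + p ^ 2)) * (Real.exp (-q ^ 2 / (1 + p ^ 2)) *
      Real.sqrt (Real.pi / (1 + p ^ 2))) := by
  have hb : 0 < 1 + p ^ 2 := by positivity
  set m := p * q / (1 + p ^ 2) with hm
  have e : ∀ x : ℝ, x * (Real.exp (-x ^ 2) * Real.exp (-(p * x + q) ^ 2)) =
      Real.exp (-q ^ 2 / (1 + p ^ 2)) *
      (fun y : ℝ => y * Real.exp (-(1 + p ^ 2) * y ^ 2)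
        - m * Real.exp (-(1 + p ^ 2) * y ^ 2)) (x + m) := by
    intro x
    rw [eb_sq]
    simp only [← hm]
    ring
  simp_rw [e]
  rw [integral_const_mul, integral_add_right_eq_self (fun y : ℝ => y * Real.exp (-(1 + p ^ 2) * y ^ 2)
        - m * Real.exp (-(1 + p ^ 2) * y ^ 2)), integral_sub, integral_const_mul, eb_odd_zero,
        integral_gaussian]
  · ring
  · exact integrable_mul_exp_neg_mul_sq hb
  · exact (integrable_exp_neg_mul_sq hb).const_mul _

lemma eb_I0 (p q : ℝ) : ∫ x : ℝ, Real.exp (-x ^ 2) * erf (p * x + q)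
    = Real.sqrt Real.pi * erf (q / Real.sqrt (1 + p ^ 2)) := by
  have hpi : 0 < Real.sqrt Real.pi := Real.sqrt_pos.2 Real.pi_pos
  have hb : 0 < 1 + p ^ 2 := by positivity
  have hs : 0 < Real.sqrt (1 + p ^ 2) := Real.sqrt_pos.2 hb
  have hd1 : ∀ q : ℝ, HasDerivAt (fun q => ∫ x : ℝ, Real.exp (-x ^ 2) * erf (p * x + q))
      (∫ x : ℝ, Real.exp (-x ^ 2) * ((2 / Real.sqrt Real.pi) * Real.exp (-(p * x + q) ^ 2))) q := by
    intro q
    refine (hasDerivAt_integral_of_dominated_loc_of_deriv_le (s := Set.univ)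
      (bound := fun x : ℝ => Real.exp (-x ^ 2) * (2 / Real.sqrt Real.pi))
      (F' := fun q x => Real.exp (-x ^ 2) * ((2 / Real.sqrt Real.pi) * Real.exp (-(p * x + q) ^ 2)))
      Filter.univ_mem ?_ ?_ ?_ ?_ ?_ ?_).2
    · exact Filter.Eventually.of_forall fun q => (eb_mul_erf eb_gauss_int p q).aestronglyMeasurable
    · exact eb_mul_erf eb_gauss_int p q
    · exact Continuous.aestronglyMeasurable (by fun_prop)
    · refine Filter.Eventually.of_forall fun x y _ => ?_
      rw [Real.norm_of_nonneg (by positivity)]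
      gcongr
      have : Real.exp (-(p * x + y) ^ 2) ≤ 1 := Real.exp_le_one_iff.2 (by nlinarith [sq_nonneg (p * x + y)])
      have h2 : 0 < 2 / Real.sqrt Real.pi := by positivity
      nlinarith
    · exact eb_gauss_int.mul_const _
    · refine Filter.Eventually.of_forall fun x y _ => ?_
      have := (eb_hasDeriv (p * x + y)).comp y ((hasDerivAt_id y).const_add (p * x))
      simpa using this.const_mul (Real.exp (-x ^ 2))
  have hd2 : ∀ q : ℝ, HasDerivAt (fun q => Real.sqrt Real.pi * erf (q / Real.sqrt (1 + p ^ 2)))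
      (Real.sqrt Real.pi * ((2 / Real.sqrt Real.pi) * Real.exp (-(q / Real.sqrt (1 + p ^ 2)) ^ 2)
        * (1 / Real.sqrt (1 + p ^ 2)))) q := by
    intro q
    exact ((eb_hasDeriv _).comp q ((hasDerivAt_id q).div_const _)).const_mul _
  have heq : ∀ q : ℝ, (∫ x : ℝ, Real.exp (-x ^ 2) * ((2 / Real.sqrt Real.pi) * Real.exp (-(p * x + q) ^ 2)))
     = (Real.sqrt Real.pi * ((2 / Real.sqrt Real.pi) * Real.exp (-(q / Real.sqrt (1 + p ^ 2)) ^ 2)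
        * (1 / Real.sqrt (1 + p ^ 2)))) := by
    intro q
    have : ∀ x : ℝ, Real.exp (-x ^ 2) * ((2 / Real.sqrt Real.pi) * Real.exp (-(p * x + q) ^ 2))
      = (2 / Real.sqrt Real.pi) * (Real.exp (-x ^ 2) * Real.exp (-(p * x + q) ^ 2)) := by
      intro x; ring
    simp_rw [this]
    rw [integral_const_mul, eb_G, div_pow, Real.sq_sqrt hb.le, Real.sqrt_div Real.pi_pos.le, neg_div]
    field_simp
  have hD : ∀ q : ℝ, HasDerivAt (fun q => (∫ x : ℝ, Real.exp (-x ^ 2) * erf (p * x + q))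
      - Real.sqrt Real.pi * erf (q / Real.sqrt (1 + p ^ 2))) 0 q := by
    intro q
    have := (hd1 q).sub (hd2 q)
    rw [heq, sub_self] at this
    exact this
  have hc := is_const_of_deriv_eq_zero (fun q => (hD q).differentiableAt) (fun q => (hD q).deriv) q 0
  have h0 : ∫ x : ℝ, Real.exp (-x ^ 2) * erf (p * x + 0) = 0 := by
    have h := integral_neg_eq_self (fun x : ℝ => Real.exp (-x ^ 2) * erf (p * x + 0)) volume
    have e : ∀ x : ℝ, Real.exp (-(-x) ^ 2) * erf (p * (-x) + 0)
      = - (Real.exp (-x ^ 2) * erf (p * x + 0)) := by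
      intro x
      rw [neg_sq, add_zero, add_zero, mul_neg, eb_odd]; ring
    simp_rw [e] at h
    rw [integral_neg] at h
    linarith
  have h00 : erf 0 = 0 := by simp [erf]
  simp only [h0, zero_div, h00] at hc
  linarith

lemma eb_I2 (p q : ℝ) : ∫ x : ℝ, x ^ 2 * Real.exp (-x ^ 2) * erf (p * x + q)
    = (1 / 2) * (∫ x : ℝ, Real.exp (-x ^ 2) * erf (p * x + q))
      + p / Real.sqrt Real.pi * ∫ x : ℝ, x * (Real.exp (-x ^ 2) * Real.exp (-(p * x + q) ^ 2)) := by
  have i0 := eb_mul_erf eb_gauss_int p q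
  have i1 := eb_mul_erf eb_id_int p q
  have i2 := eb_mul_erf eb_sq_int p q
  have i3 : Integrable (fun x : ℝ => x * (Real.exp (-x ^ 2) * Real.exp (-(p * x + q) ^ 2))) := by
    have : Integrable (fun x : ℝ => x * Real.exp (-x ^ 2) * Real.exp (-(p * x + q) ^ 2)) := by
      refine eb_id_int.mul_bdd (c := 1) (Continuous.aestronglyMeasurable (by fun_prop))
        (Filter.Eventually.of_forall fun x => ?_)
      rw [Real.norm_of_nonneg (Real.exp_pos _).le]
      exact Real.exp_le_one_iff.2 (by nlinarith [sq_nonneg (p * x + q)])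
    simpa only [mul_assoc] using this
  have hd : ∀ x : ℝ, HasDerivAt (fun x : ℝ => x * Real.exp (-x ^ 2) * erf (p * x + q))
      ((Real.exp (-x ^ 2) * erf (p * x + q) - 2 * (x ^ 2 * Real.exp (-x ^ 2) * erf (p * x + q)))
       + 2 * p / Real.sqrt Real.pi * (x * (Real.exp (-x ^ 2) * Real.exp (-(p * x + q) ^ 2)))) x := by
    intro x
    have h1 : HasDerivAt (fun x : ℝ => erf (p * x + q))
      ((2 / Real.sqrt Real.pi) * Real.exp (-(p * x + q) ^ 2) * (p * 1)) x :=
      HasDerivAt.comp (h₂ := erf) (h := fun x : ℝ => p * x + q) x (eb_hasDeriv (p * x + q))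
        (((hasDerivAt_id x).const_mul p).add_const q)
    have h2 : HasDerivAt (fun x : ℝ => Real.exp (-x ^ 2)) (Real.exp (-x ^ 2) * (-(2 * x))) x := by
      have := ((hasDerivAt_pow 2 x).neg).exp
      simpa using this
    refine (((hasDerivAt_id x).mul h2).mul h1).congr_deriv ?_
    simp only [id, Pi.mul_apply]
    ring
  have hz := integral_eq_zero_of_hasDerivAt_of_integrable hd
    ((i0.sub (i2.const_mul 2)).add (i3.const_mul _)) i1
  rw [integral_add (by exact i0.sub (i2.const_mul 2)) (i3.const_mul _), integral_sub i0 (i2.const_mul 2),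
    integral_const_mul, integral_const_mul] at hz
  linear_combination (-1 / 2) * hz

lemma eb_S : ∫ x : ℝ, x ^ 2 * Real.exp (-x ^ 2) = Real.sqrt Real.pi / 2 := by
  have hd : ∀ x : ℝ, HasDerivAt (fun x : ℝ => x * Real.exp (-x ^ 2))
      (Real.exp (-x ^ 2) - 2 * (x ^ 2 * Real.exp (-x ^ 2))) x := by
    intro x
    have h2 : HasDerivAt (fun x : ℝ => Real.exp (-x ^ 2)) (Real.exp (-x ^ 2) * (-(2 * x))) x := by
      have := ((hasDerivAt_pow 2 x).neg).exp
      simpa using this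
    refine ((hasDerivAt_id x).mul h2).congr_deriv ?_
    simp only [id]
    ring
  have hz := integral_eq_zero_of_hasDerivAt_of_integrable hd
    (eb_gauss_int.sub (eb_sq_int.const_mul 2)) eb_id_int
  rw [integral_sub eb_gauss_int (eb_sq_int.const_mul 2), integral_const_mul, eb_gauss_val] at hz
  linarith

/-- Normalized integral. -/
lemma eb_main (p q L : ℝ) :
    ∫ x : ℝ, (1 / 2) * (1 + erf (p * x + q)) * Real.exp (-x ^ 2) * (L - x ^ 2)
    = Real.sqrt Real.pi * ((1 / 2) * (L - 1 / 2) * (1 + erf (q / Real.sqrt (1 + p ^ 2)))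
      + (1 / 2) * p ^ 2 * q / (Real.sqrt Real.pi * (1 + p ^ 2) * Real.sqrt (1 + p ^ 2))
        * Real.exp (-q ^ 2 / (1 + p ^ 2))) := by
  have i0 := eb_mul_erf eb_gauss_int p q
  have i2 := eb_mul_erf eb_sq_int p q
  have e : ∀ x : ℝ, (1 / 2) * (1 + erf (p * x + q)) * Real.exp (-x ^ 2) * (L - x ^ 2)
    = (L / 2 * (Real.exp (-x ^ 2)) - 1 / 2 * (x ^ 2 * Real.exp (-x ^ 2)))
     + (L / 2 * (Real.exp (-x ^ 2) * erf (p * x + q))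
        - 1 / 2 * (x ^ 2 * Real.exp (-x ^ 2) * erf (p * x + q))) := by
    intro x; ring
  simp_rw [e]
  rw [integral_add (by exact (eb_gauss_int.const_mul _).sub (eb_sq_int.const_mul _))
    (by exact (i0.const_mul _).sub (i2.const_mul _)),
    integral_sub (eb_gauss_int.const_mul _) (eb_sq_int.const_mul _),
    integral_sub (i0.const_mul _) (i2.const_mul _)]
  simp only [integral_const_mul]
  rw [eb_I2, eb_J, eb_I0, eb_S, eb_gauss_val, Real.sqrt_div Real.pi_pos.le]
  have hpi : 0 < Real.sqrt Real.pi := Real.sqrt_pos.2 Real.pi_pos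
  have hb : 0 < 1 + p ^ 2 := by positivity
  have hs : 0 < Real.sqrt (1 + p ^ 2) := Real.sqrt_pos.2 hb
  field_simp
  ring

/-- **Closed form for the body component of the entropy (Gaussian case).**
With `f` the density of `N(a, σ²/N_a)` and `Φ_b` the CDF of `N(b, σ²/N_b)`,
`−∫ Φ_b(θ) f(θ) ln f(θ) dθ
  = (1/2) ln(2πσ²e/N_a) [1 − (1/2)erfc(√(N_bN_a)(a−b)/√(2σ²(N_b+N_a)))]
    − (√N_a N_b^{3/2}(a−b)/(2σ√(2π)(N_a+N_b)^{3/2})) e^{−N_bN_a(a−b)²/(2σ²(N_b+N_a))}`. -/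
theorem entropy_body_closed_form (σ Na Nb a b : ℝ)
    (hσ : 0 < σ) (hNa : 0 < Na) (hNb : 0 < Nb)
    (f : ℝ → ℝ)
    (hf : f = fun θ => Real.sqrt Na / Real.sqrt (2 * Real.pi * σ ^ 2)
      * Real.exp (-(Na * (θ - a) ^ 2) / (2 * σ ^ 2)))
    (Φb : ℝ → ℝ)
    (hΦb : Φb = fun θ => (1 / 2) * (1 + erf (Real.sqrt Nb * (θ - b) / Real.sqrt (2 * σ ^ 2)))) :
    -∫ θ : ℝ, Φb θ * f θ * Real.log (f θ)
      = (1 / 2) * Real.log (2 * Real.pi * σ ^ 2 * Real.exp 1 / Na)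
          * (1 - (1 / 2) * erfc (Real.sqrt (Nb * Na) * (a - b)
              / Real.sqrt (2 * σ ^ 2 * (Nb + Na))))
        - (Real.sqrt Na * Nb ^ ((3 : ℝ) / 2) * (a - b)
              / (2 * σ * Real.sqrt (2 * Real.pi) * (Na + Nb) ^ ((3 : ℝ) / 2)))
          * Real.exp (-(Nb * Na * (a - b) ^ 2) / (2 * σ ^ 2 * (Nb + Na))) := by
  set ra := Real.sqrt Na with hra
  set rb := Real.sqrt Nb with hrb
  set w := Real.sqrt 2 with hw
  set P := Real.sqrt Real.pi with hP
  have ra0 : 0 < ra := Real.sqrt_pos.2 hNa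
  have rb0 : 0 < rb := Real.sqrt_pos.2 hNb
  have w0 : 0 < w := Real.sqrt_pos.2 two_pos
  have P0 : 0 < P := Real.sqrt_pos.2 Real.pi_pos
  have ra2 : ra ^ 2 = Na := Real.sq_sqrt hNa.le
  have rb2 : rb ^ 2 = Nb := Real.sq_sqrt hNb.le
  have w2 : w ^ 2 = 2 := Real.sq_sqrt two_pos.le
  have P2 : P ^ 2 = Real.pi := Real.sq_sqrt Real.pi_pos.le
  set r := Real.sqrt (Na + Nb) with hr
  have hN : 0 < Na + Nb := by positivity
  have r0 : 0 < r := Real.sqrt_pos.2 hN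
  have r2 : r ^ 2 = Na + Nb := Real.sq_sqrt hN.le
  have s1 : Real.sqrt (2 * σ ^ 2) = w * σ := by
    rw [Real.sqrt_mul two_pos.le, Real.sqrt_sq hσ.le]
  have s2 : Real.sqrt (2 * Real.pi) = w * P := by
    rw [Real.sqrt_mul two_pos.le]
  have s3 : Real.sqrt (2 * Real.pi * σ ^ 2) = w * P * σ := by
    rw [Real.sqrt_mul (by positivity), Real.sqrt_sq hσ.le, s2]
  have s4 : Real.sqrt (2 * σ ^ 2 * (Nb + Na)) = w * σ * r := by
    rw [Real.sqrt_mul (by positivity), s1, add_comm Nb Na]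
  have s5 : Real.sqrt (Nb * Na) = rb * ra := by
    rw [Real.sqrt_mul hNb.le]
  have t : ∀ x : ℝ, 0 < x → x ^ ((3 : ℝ) / 2) = x * Real.sqrt x := by
    intro x hx
    rw [Real.sqrt_eq_rpow, ← Real.rpow_one_add' hx.le (by norm_num)]
    norm_num
  rw [t Nb hNb, t (Na + Nb) hN, s2, s4, s5, ← hrb, ← hr]
  set κ := w * σ / ra with hκ
  have κ0 : 0 < κ := by positivity
  set p := rb / ra with hp
  set q := rb * (a - b) / (w * σ) with hq
  set L := Real.log (1 / (κ * P)) with hL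
  have sp : Real.sqrt (1 + p ^ 2) = r / ra := by
    rw [hr, hra, ← Real.sqrt_div hN.le, hp, div_pow, ra2, rb2]
    congr 1
    field_simp
  have hlog : Real.log (2 * Real.pi * σ ^ 2 * Real.exp 1 / Na) = 1 - 2 * L := by
    have : 2 * Real.pi * σ ^ 2 * Real.exp 1 / Na = (κ * P) ^ 2 * Real.exp 1 := by
      rw [hκ, ← w2, ← P2, ← ra2]; field_simp
    rw [this, Real.log_mul (by positivity) (by positivity), Real.log_exp, Real.log_pow, hL,
      one_div, Real.log_inv]
    push_cast
    ring
  have hcv : ∫ θ : ℝ, Φb θ * f θ * Real.log (f θ)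
      = κ * ∫ x : ℝ, Φb (κ * x + a) * f (κ * x + a) * Real.log (f (κ * x + a)) := by
    rw [Measure.integral_comp_mul_left (fun y => Φb (y + a) * f (y + a) * Real.log (f (y + a))) κ,
      integral_add_right_eq_self (fun θ => Φb θ * f θ * Real.log (f θ)), abs_of_pos (by positivity),
      smul_eq_mul]
    field_simp
  have hfx : ∀ x : ℝ, f (κ * x + a) = 1 / (κ * P) * Real.exp (-x ^ 2) := by
    intro x
    rw [hf]
    simp only []
    rw [s3]
    congr 1
    · rw [hκ]; field_simp
    · congr 1
      rw [hκ, ← ra2, ← w2]; field_simp; ring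
  have hlf : ∀ x : ℝ, Real.log (f (κ * x + a)) = L - x ^ 2 := by
    intro x
    rw [hfx, Real.log_mul (by positivity) (by positivity), Real.log_exp]
    ring
  have hΦx : ∀ x : ℝ, Φb (κ * x + a) = (1 / 2) * (1 + erf (p * x + q)) := by
    intro x
    rw [hΦb]
    simp only []
    rw [s1]
    congr 3
    rw [hκ, hp, hq]; field_simp; ring
  have e : ∀ x : ℝ, Φb (κ * x + a) * f (κ * x + a) * Real.log (f (κ * x + a))
      = 1 / (κ * P) * ((1 / 2) * (1 + erf (p * x + q)) * Real.exp (-x ^ 2) * (L - x ^ 2)) := by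
    intro x
    rw [hlf, hfx, hΦx]; ring
  rw [hcv]
  simp_rw [e]
  rw [integral_const_mul, eb_main, ← hP, hlog, sp]
  have p1 : 1 + p ^ 2 = r ^ 2 / ra ^ 2 := by
    rw [← div_pow, ← sp, Real.sq_sqrt (by positivity)]
  have E1 : rb * ra * (a - b) / (w * σ * r) = q / (r / ra) := by
    rw [hq]; field_simp
  have E2 : -(Nb * Na * (a - b) ^ 2) / (2 * σ ^ 2 * (Nb + Na)) = -q ^ 2 / (1 + p ^ 2) := by
    rw [p1, hq, add_comm Nb Na, ← r2, ← ra2, ← rb2, ← w2]; field_simp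
  rw [E1, E2, p1, ← r2]
  unfold erfc
  generalize Real.exp _ = X
  generalize erf _ = Y
  rw [hp, hq, ← rb2]
  field_simp
  ring
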